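/- Let g be a Riemannian metric on Ω admitting a Levi-Civita connection form A of class C³, with curvature R. Let Δ ⊆ ℝ² be an open disc of radius r₀ centered at the origin and e : Δ → Ω a C⁵ map such that for every unit vector ρ ∈ ℝ² the curve t ↦ e(tρ), t ∈ [0, r₀), is a geodesic for A of unit speed: g_{e(tρ)}((d/dt)e(tρ), (d/dt)e(tρ)) = 1. Set v = e(0), ξ = ∂₁e(0), η = ∂₂e(0) and K = g_v(R(v)(ξ, η)η, ξ). Then ξ, η are g_v-orthonormal, and the length L(r) = ∫₀^{2π} g_{e(r cos θ, r sin θ)}(∂_θ e(r cos θ, r sin θ), ∂_θ e(r cos θ, r sin θ))^{1/2} dθ of the geodesic circle of radius r satisfies L(r) = 2πr − (πK/3) r³ + o(r³) as r → 0⁺. -/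

import Mathlib

open scoped Topology
open Asymptotics

noncomputable section

/-- A Riemannian metric on `Ω`: a family of symmetric positive definite continuous bilinear
forms. -/
def IsRiemannianMetric {V : Type*} [NormedAddCommGroup V] [NormedSpace ℝ V]
    (Ω : Set V) (g : V → V →L[ℝ] V →L[ℝ] ℝ) : Prop :=
  (∀ v ∈ Ω, ∀ ξ η : V, g v ξ η = g v η ξ) ∧ ∀ v ∈ Ω, ∀ ξ : V, ξ ≠ 0 → 0 < g v ξ ξ

/-- `A` is a Levi-Civita connection form for `g` on `Ω` (torsion-free and compatible). -/
def IsLeviCivita {V : Type*} [NormedAddCommGroup V] [NormedSpace ℝ V]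
    (Ω : Set V) (g : V → V →L[ℝ] V →L[ℝ] ℝ) (A : V → V →L[ℝ] V →L[ℝ] V) : Prop :=
  (∀ v ∈ Ω, ∀ ξ η : V, A v ξ η = A v η ξ) ∧
  ∀ v ∈ Ω, ∀ η ζ : V, HasFDerivAt (fun w => g w η ζ)
    (((g v).flip ζ).comp ((A v).flip η) + ((g v) η).comp ((A v).flip ζ)) v

/-- The curvature of a connection form `A`. -/
def curvature {V W : Type*} [NormedAddCommGroup V] [NormedSpace ℝ V]
    [NormedAddCommGroup W] [NormedSpace ℝ W]
    (A : V → V →L[ℝ] W →L[ℝ] W) (v : V) (ξ η : V) : W →L[ℝ] W :=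
  fderiv ℝ A v ξ η - fderiv ℝ A v η ξ + (A v ξ).comp (A v η) - (A v η).comp (A v ξ)

/-- The point `(r cos θ, r sin θ)` of the plane `ℝ²`. -/
def circPt (r θ : ℝ) : EuclideanSpace ℝ (Fin 2) :=
  (r * Real.cos θ) • EuclideanSpace.single (0 : Fin 2) (1 : ℝ) +
    (r * Real.sin θ) • EuclideanSpace.single (1 : Fin 2) (1 : ℝ)

/-- The tangent vector `∂/∂θ (r cos θ, r sin θ) = (-r sin θ, r cos θ)`. -/
def circTang (r θ : ℝ) : EuclideanSpace ℝ (Fin 2) :=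
  (-(r * Real.sin θ)) • EuclideanSpace.single (0 : Fin 2) (1 : ℝ) +
    (r * Real.cos θ) • EuclideanSpace.single (1 : Fin 2) (1 : ℝ)

section GeodesicCircles

set_option maxSynthPendingDepth 3

/-- A function on a compact convex set whose sublevel sets are closed, and whose increase along a
segment is at most half of any upper bound on that segment, is bounded. -/
theorem exists_bound_of_segment_growth {E : Type*} [NormedAddCommGroup E] [NormedSpace ℝ E]
    [ProperSpace E]
    {D : Set E} (hD : IsCompact D) (hconv : Convex ℝ D) (N : E → ℝ)
    (hclosed : ∀ c, IsClosed {x ∈ D | N x ≤ c})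
    (hstep : ∀ a ∈ D, ∀ b ∈ D, ∀ m, (∀ x ∈ segment ℝ a b, N x ≤ m) → N b ≤ N a + m / 2) :
    ∃ M, ∀ x ∈ D, N x ≤ M := by
  have hdouble : ∀ a ∈ D, ∀ b ∈ D, (∃ m, ∀ x ∈ segment ℝ a b, N x ≤ m) → N b ≤ 2 * N a := by
    rintro a ha b hb ⟨m, hm⟩
    have hbdd : BddAbove (N '' segment ℝ a b) := ⟨m, by rintro _ ⟨x, hx, rfl⟩; exact hm x hx⟩
    have hle : ∀ x ∈ segment ℝ a b, N x ≤ sSup (N '' segment ℝ a b) :=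
      fun x hx => le_csSup hbdd ⟨x, hx, rfl⟩
    have hsup : sSup (N '' segment ℝ a b) ≤ N a + sSup (N '' segment ℝ a b) / 2 := by
      apply csSup_le ⟨N a, Set.mem_image_of_mem N (left_mem_segment ℝ a b)⟩
      rintro _ ⟨x, hx, rfl⟩
      refine hstep a ha x (hconv.segment_subset ha hb hx) _ fun y hy => hle y ?_
      exact (convex_segment a b).segment_subset (left_mem_segment ℝ a b) hx hy
    have := hle b (right_mem_segment ℝ a b)
    linarith
  set U : Set E := ⋃₀ {u | IsOpen u ∧ ∃ M, ∀ y ∈ D ∩ u, N y ≤ M} with hU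
  have hUopen : IsOpen U := isOpen_sUnion fun u hu => hu.1
  have hcompact : ∀ K ⊆ D, IsCompact K → K ⊆ U → ∃ M, ∀ x ∈ K, N x ≤ M := by
    intro K hKD hK hKU
    refine hK.induction_on (p := fun s => ∃ M, ∀ x ∈ s, N x ≤ M) ⟨0, by simp⟩ ?_ ?_ ?_
    · rintro s t hst ⟨M, hM⟩
      exact ⟨M, fun x hx => hM x (hst hx)⟩
    · rintro s t ⟨M, hM⟩ ⟨M', hM'⟩
      refine ⟨max M M', ?_⟩
      rintro x (hx | hx)
      · exact (hM x hx).trans (le_max_left _ _)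
      · exact (hM' x hx).trans (le_max_right _ _)
    · intro x hx
      obtain ⟨u, ⟨hu, M, hM⟩, hxu⟩ := hKU hx
      refine ⟨D ∩ u, ?_, M, hM⟩
      exact Filter.inter_mem (Filter.mem_of_superset self_mem_nhdsWithin hKD)
        (mem_nhdsWithin_of_mem_nhds (hu.mem_nhds hxu))
  rcases (D \ U).eq_empty_or_nonempty with hemp | hne
  · exact hcompact D subset_rfl hD (Set.sdiff_eq_empty.1 hemp)
  exfalso
  have hFcl : IsClosed (D \ U) := hD.isClosed.sdiff hUopen
  have : CompactSpace ↥(D \ U) :=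
    isCompact_iff_compactSpace.1 (hD.diff hUopen)
  have : Nonempty ↥(D \ U) := hne.to_subtype
  obtain ⟨n, ⟨x, hxD, hxU⟩, hx⟩ := nonempty_interior_of_iUnion_of_closed
    (f := fun n : ℕ => {x : ↥(D \ U) | N x ≤ n})
    (fun n => by
      convert (hclosed n).preimage (continuous_subtype_val (p := fun x => x ∈ D \ U)) using 1
      ext y
      simp [y.2.1])
    (by
      ext y
      simpa using exists_nat_ge (N y))
  obtain ⟨δ, hδ, hball⟩ := Metric.mem_nhds_iff.1 (mem_interior_iff_mem_nhds.1 hx)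
  have hn : ∀ a ∈ D \ U, dist a x < δ → N a ≤ n := fun a ha hax =>
    hball (a := ⟨a, ha⟩) hax
  refine hxU ⟨Metric.ball x (δ / 2), ⟨Metric.isOpen_ball, max n (2 * n), ?_⟩,
    Metric.mem_ball_self (half_pos hδ)⟩
  rintro t ⟨htD, ht⟩
  rw [Metric.mem_ball] at ht
  by_cases htU : t ∈ U
  swap
  · exact (hn t ⟨htD, htU⟩ (by linarith)).trans (le_max_left _ _)
  obtain ⟨a, ha, hta⟩ := hFcl.exists_infDist_eq_dist ⟨x, hxD, hxU⟩ t
  have hnear : ∀ y ∈ D \ U, dist t a ≤ dist t y := fun y hy =>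
    hta ▸ Metric.infDist_le_dist_of_mem hy
  have hax : dist a x < δ := by
    have h1 := hnear x ⟨hxD, hxU⟩
    have h2 := dist_triangle_left a x t
    linarith
  have hlt : ∀ s ∈ segment ℝ a t, s ≠ a → dist t s < dist t a := by
    intro s hs hsa
    have h1 := dist_add_dist_of_mem_segment hs
    have h2 : 0 < dist a s := dist_pos.2 (Ne.symm hsa)
    rw [dist_comm t s, dist_comm t a]
    linarith
  have hbd : ∀ s ∈ segment ℝ a t, N s ≤ max (N a) (2 * N t) := by
    intro s hs
    by_cases hsa : s = a
    · rw [hsa]; exact le_max_left _ _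
    have hsD : s ∈ D := hconv.segment_subset ha.1 htD hs
    refine le_trans (hdouble t htD s hsD ?_) (le_max_right _ _)
    refine hcompact _ (hconv.segment_subset htD hsD) ?_ ?_
    · rw [← convexHull_pair]
      exact (Set.toFinite _).isCompact_convexHull ℝ
    · intro y hy
      by_contra hyU
      have hyD : y ∈ D := hconv.segment_subset htD hsD hy
      have h1 := hnear y ⟨hyD, hyU⟩
      have h2 := dist_add_dist_of_mem_segment hy
      have h3 := hlt s hs hsa
      have h4 : 0 ≤ dist y s := dist_nonneg
      linarith
  have := hdouble a ha.1 t htD ⟨_, hbd⟩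
  have h2 := hn a ha hax
  refine le_trans ?_ (le_max_right _ _)
  linarith

/-- Mean value inequality in norm for families of bilinear forms with weak derivatives. -/
theorem norm_bilin_sub_le_of_weak_hasFDerivAt {E V : Type*} [NormedAddCommGroup E]
    [NormedSpace ℝ E] [NormedAddCommGroup V] [NormedSpace ℝ V] {s : Set E} (hs : Convex ℝ s)
    {G : E → V →L[ℝ] V →L[ℝ] ℝ} {L : E → E →L[ℝ] V →L[ℝ] V →L[ℝ] ℝ}
    (hG : ∀ p ∈ s, ∀ η ζ, HasFDerivAt (fun p => G p η ζ) (((L p).flip η).flip ζ) p)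
    {φ : E →L[ℝ] V →L[ℝ] V →L[ℝ] ℝ} {C : ℝ} (hL : ∀ p ∈ s, ‖L p - φ‖ ≤ C) {p q : E}
    (hp : p ∈ s) (hq : q ∈ s) : ‖G q - G p - φ (q - p)‖ ≤ C * ‖q - p‖ := by
  have hC : 0 ≤ C := (norm_nonneg _).trans (hL p hp)
  refine ContinuousLinearMap.opNorm_le_bound₂ _ (by positivity) fun η ζ => ?_
  have key := hs.norm_image_sub_le_of_norm_hasFDerivWithin_le'
    (f := fun p => G p η ζ) (𝕜 := ℝ) (f' := fun p => ((L p).flip η).flip ζ) (φ := ((φ.flip η).flip ζ))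
    (C := C * ‖η‖ * ‖ζ‖) (s := s) (x := p) (y := q) (fun x hx => (hG x hx η ζ).hasFDerivWithinAt) (fun x hx => ?_) hp hq
  · calc _ ≤ C * ‖η‖ * ‖ζ‖ * ‖q - p‖ := by simpa using key
      _ = _ := by ring
  · refine ContinuousLinearMap.opNorm_le_bound _ (by positivity) fun u => ?_
    calc _ = ‖(L x - φ) u η ζ‖ := by simp
      _ ≤ ‖(L x - φ)‖ * ‖u‖ * ‖η‖ * ‖ζ‖ := by
        refine (ContinuousLinearMap.le_opNorm₂ _ _ _).trans ?_
        gcongr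
        exact ContinuousLinearMap.le_opNorm _ _
      _ ≤ C * ‖u‖ * ‖η‖ * ‖ζ‖ := by gcongr; exact hL x hx
      _ = _ := by ring

/-- The derivative of a bilinear form that is parallel for the pulled back connection form `a`. -/
def parallelDeriv {E V : Type*} [NormedAddCommGroup E] [NormedSpace ℝ E] [NormedAddCommGroup V]
    [NormedSpace ℝ V] (G : V →L[ℝ] V →L[ℝ] ℝ) (a : E →L[ℝ] V →L[ℝ] V) :
    E →L[ℝ] V →L[ℝ] V →L[ℝ] ℝ :=
  (ContinuousLinearMap.compL ℝ V V (V →L[ℝ] ℝ) G).comp a +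
    ((ContinuousLinearMap.flipₗᵢ ℝ V V ℝ : (V →L[ℝ] V →L[ℝ] ℝ) →L[ℝ] V →L[ℝ] V →L[ℝ] ℝ)).comp
      ((ContinuousLinearMap.compL ℝ V V (V →L[ℝ] ℝ) G.flip).comp a)

section ParallelForm

variable {E V : Type*} [NormedAddCommGroup E] [NormedSpace ℝ E] [NormedAddCommGroup V]
  [NormedSpace ℝ V]

@[simp]
theorem parallelDeriv_apply (G : V →L[ℝ] V →L[ℝ] ℝ) (a : E →L[ℝ] V →L[ℝ] V) (u : E) (η ζ : V) :
    parallelDeriv G a u η ζ = G (a u η) ζ + G η (a u ζ) := by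
  simp [parallelDeriv]

theorem norm_parallelDeriv_le (G : V →L[ℝ] V →L[ℝ] ℝ) (a : E →L[ℝ] V →L[ℝ] V) :
    ‖parallelDeriv G a‖ ≤ 2 * ‖a‖ * ‖G‖ := by
  refine ContinuousLinearMap.opNorm_le_bound _ (by positivity) fun u => ?_
  refine ContinuousLinearMap.opNorm_le_bound₂ _ (by positivity) fun η ζ => ?_
  have ha : ∀ η, ‖a u η‖ ≤ ‖a‖ * ‖u‖ * ‖η‖ := fun η => ContinuousLinearMap.le_opNorm₂ _ _ _
  rw [parallelDeriv_apply]
  calc _ ≤ ‖G (a u η) ζ‖ + ‖G η (a u ζ)‖ := norm_add_le _ _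
    _ ≤ ‖G‖ * ‖a u η‖ * ‖ζ‖ + ‖G‖ * ‖η‖ * ‖a u ζ‖ := by
      gcongr <;> exact ContinuousLinearMap.le_opNorm₂ _ _ _
    _ ≤ ‖G‖ * (‖a‖ * ‖u‖ * ‖η‖) * ‖ζ‖ + ‖G‖ * ‖η‖ * (‖a‖ * ‖u‖ * ‖ζ‖) := by
      gcongr <;> exact ha _
    _ = _ := by ring

/-- A family of bilinear forms that is weakly parallel for a continuous connection form is
locally bounded in norm. -/
theorem exists_bound_of_weak_parallel [ProperSpace E] {U : Set E} (hU : U ∈ 𝓝 (0 : E))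
    {G : E → V →L[ℝ] V →L[ℝ] ℝ} {a : E → E →L[ℝ] V →L[ℝ] V} (ha : ContinuousAt a 0)
    (hG : ∀ p ∈ U, ∀ η ζ, HasFDerivAt (fun p => G p η ζ)
      (((parallelDeriv (G p) (a p)).flip η).flip ζ) p) :
    ∃ r > 0, Metric.ball 0 r ⊆ U ∧ ∃ M, ∀ p ∈ Metric.ball (0 : E) r, ‖G p‖ ≤ M := by
  set C : ℝ := ‖a 0‖ + 1 with hC
  have hCpos : 0 < C := by positivity
  have haC : ∀ᶠ p in 𝓝 (0 : E), ‖a p‖ ≤ C :=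
    (ha.norm.eventually (gt_mem_nhds (lt_add_one ‖a 0‖))).mono fun p hp => hp.le
  obtain ⟨r₁, hr₁, hball⟩ := Metric.mem_nhds_iff.1 (Filter.inter_mem hU haC)
  set r := min (r₁ / 2) (1 / (8 * C)) with hr
  have hrpos : 0 < r := by positivity
  have hsub : Metric.closedBall (0 : E) r ⊆ U ∩ {p | ‖a p‖ ≤ C} :=
    (Metric.closedBall_subset_ball (by have := min_le_left (r₁ / 2) (1 / (8 * C)); linarith)).trans
      hball
  have hrC : 8 * C * r ≤ 1 := by
    have := min_le_right (r₁ / 2) (1 / (8 * C))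
    rw [← hr, le_div_iff₀ (by positivity)] at this
    linarith
  suffices h : ∃ M, ∀ p ∈ Metric.closedBall (0 : E) r, ‖G p‖ ≤ M by
    obtain ⟨M, hM⟩ := h
    exact ⟨r, hrpos, fun p hp => (hsub (Metric.ball_subset_closedBall hp)).1, M,
      fun p hp => hM p (Metric.ball_subset_closedBall hp)⟩
  refine exists_bound_of_segment_growth (isCompact_closedBall (0 : E) r)
    (convex_closedBall 0 r) (fun p => ‖G p‖) ?_ ?_
  · intro c
    rcases lt_or_ge c 0 with hc | hc
    · convert isClosed_empty
      ext p
      have := hc.trans_le (norm_nonneg (G p))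
      simp [this]
    have : {x ∈ Metric.closedBall (0 : E) r | ‖G x‖ ≤ c} =
        ⋂ η : V, ⋂ ζ : V, {x ∈ Metric.closedBall (0 : E) r | ‖G x η ζ‖ ≤ c * ‖η‖ * ‖ζ‖} := by
      ext x
      simp only [Set.mem_iInter, Set.mem_ofPred_eq]
      constructor
      · rintro ⟨h1, h2⟩ η ζ
        refine ⟨h1, (ContinuousLinearMap.le_opNorm₂ _ _ _).trans ?_⟩
        gcongr
      · intro h
        exact ⟨(h 0 0).1, ContinuousLinearMap.opNorm_le_bound₂ _ hc fun η ζ => (h η ζ).2⟩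
    rw [this]
    refine isClosed_iInter fun η => isClosed_iInter fun ζ => ?_
    refine ContinuousOn.preimage_isClosed_of_isClosed (f := fun x => ‖G x η ζ‖)
      (t := Set.Iic (c * ‖η‖ * ‖ζ‖)) (fun p hp => ?_) Metric.isClosed_closedBall isClosed_Iic
    exact (hG p (hsub hp).1 η ζ).continuousAt.norm.continuousWithinAt
  · intro p hp q hq m hm
    have hseg := (convex_closedBall (0 : E) r).segment_subset hp hq
    have hm0 : 0 ≤ m := (norm_nonneg _).trans (hm p (left_mem_segment ℝ p q))
    have key := norm_bilin_sub_le_of_weak_hasFDerivAt (convex_segment p q)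
      (fun x hx => hG x (hsub (hseg hx)).1) (φ := 0) (C := 2 * C * m)
      (fun x hx => by
        rw [sub_zero]
        refine (norm_parallelDeriv_le _ _).trans ?_
        gcongr
        · exact (hsub (hseg hx)).2
        · exact hm x hx) (left_mem_segment ℝ p q) (right_mem_segment ℝ p q)
    have hpq : ‖q - p‖ ≤ 2 * r := by
      rw [mem_closedBall_zero_iff] at hp hq
      linarith [norm_sub_le q p]
    have h1 : 2 * C * m * ‖q - p‖ ≤ m / 2 := by
      calc 2 * C * m * ‖q - p‖ ≤ 2 * C * m * (2 * r) := by gcongr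
        _ = (8 * C * r) * m / 2 := by ring
        _ ≤ 1 * m / 2 := by gcongr
        _ = m / 2 := by ring
    simp only [zero_apply, sub_zero] at key
    have h2 := norm_sub_norm_le (G q) (G p)
    linarith

/-- A family of bilinear forms that is weakly parallel for a continuous connection form is
Fréchet differentiable in norm. -/
theorem eventually_hasFDerivAt_of_weak_parallel [ProperSpace E] {U : Set E}
    (hU : U ∈ 𝓝 (0 : E))
    {G : E → V →L[ℝ] V →L[ℝ] ℝ} {a : E → E →L[ℝ] V →L[ℝ] V}
    (ha : ∀ p ∈ U, ContinuousAt a p)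
    (hG : ∀ p ∈ U, ∀ η ζ, HasFDerivAt (fun p => G p η ζ)
      (((parallelDeriv (G p) (a p)).flip η).flip ζ) p) :
    ∀ᶠ p in 𝓝 (0 : E), HasFDerivAt G (parallelDeriv (G p) (a p)) p := by
  obtain ⟨r, hr, hrU, M, hM⟩ := exists_bound_of_weak_parallel hU (ha 0 (mem_of_mem_nhds hU)) hG
  filter_upwards [Metric.ball_mem_nhds (0 : E) hr] with p hp
  have hGc : ContinuousAt G p := by
    have haC : ∀ᶠ q in 𝓝 p, ‖a q‖ ≤ ‖a p‖ + 1 :=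
      ((ha p (hrU hp)).norm.eventually (gt_mem_nhds (lt_add_one ‖a p‖))).mono fun q hq => hq.le
    obtain ⟨δ, hδ, hball⟩ := Metric.mem_nhds_iff.1
      (Filter.inter_mem (Metric.isOpen_ball.mem_nhds hp) haC)
    refine continuousAt_of_locally_lipschitz hδ (2 * (‖a p‖ + 1) * M) fun q hq => ?_
    have key := norm_bilin_sub_le_of_weak_hasFDerivAt (convex_ball p δ)
      (fun x hx => hG x (hrU (hball hx).1)) (φ := 0) (C := 2 * (‖a p‖ + 1) * M)
      (fun x hx => by
        rw [sub_zero]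
        refine (norm_parallelDeriv_le _ _).trans ?_
        gcongr
        · exact (hball hx).2
        · exact hM x (hball hx).1) (Metric.mem_ball_self hδ) hq
    simpa [dist_eq_norm] using key
  have hLc : ContinuousAt (fun q => parallelDeriv (G q) (a q)) p := by
    have := ha p (hrU hp)
    unfold parallelDeriv
    have h1 : ContinuousAt (fun q => ContinuousLinearMap.flipₗᵢ ℝ V V ℝ (G q)) p :=
      (ContinuousLinearMap.flipₗᵢ ℝ V V ℝ).continuous.continuousAt.comp hGc
    have h2 : ContinuousAt (fun q => (G q).flip) p := h1
    fun_prop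
  rw [hasFDerivAt_iff_isLittleO, Asymptotics.isLittleO_iff]
  intro c hc
  obtain ⟨δ, hδ, hball⟩ := Metric.mem_nhds_iff.1 (Filter.inter_mem
    (Metric.isOpen_ball.mem_nhds hp) (hLc (Metric.closedBall_mem_nhds _ hc)))
  filter_upwards [Metric.ball_mem_nhds p hδ] with q hq
  refine norm_bilin_sub_le_of_weak_hasFDerivAt (convex_ball p δ)
      (fun x hx => hG x (hrU (hball hx).1)) (fun x hx => ?_) (Metric.mem_ball_self hδ) hq
  simpa [dist_eq_norm] using (hball hx).2

end ParallelForm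

section CovariantHessian

variable {E V : Type*} [NormedAddCommGroup E] [NormedSpace ℝ E] [NormedAddCommGroup V]
  [NormedSpace ℝ V]

/-- The pull back of the connection form `A` along `e`. -/
def pullbackConnection (A : V → V →L[ℝ] V →L[ℝ] V) (e : E → V) (p : E) : E →L[ℝ] V →L[ℝ] V :=
  (A (e p)).comp (fderiv ℝ e p)

/-- The covariant Hessian `∇(de)` of `e` with respect to the connection form `A`. -/
def covariantHessian (A : V → V →L[ℝ] V →L[ℝ] V) (e : E → V) (p : E) : E →L[ℝ] E →L[ℝ] V :=
  fderiv ℝ (fderiv ℝ e) p +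
    ((ContinuousLinearMap.compL ℝ E V V).flip (fderiv ℝ e p)).comp (pullbackConnection A e p)

variable {A : V → V →L[ℝ] V →L[ℝ] V} {e : E → V} {p : E}

@[simp]
theorem pullbackConnection_apply (u : E) (z : V) :
    pullbackConnection A e p u z = A (e p) (fderiv ℝ e p u) z := rfl

@[simp]
theorem covariantHessian_apply (u y : E) : covariantHessian A e p u y =
    fderiv ℝ (fderiv ℝ e) p u y + A (e p) (fderiv ℝ e p u) (fderiv ℝ e p y) := rfl

theorem fderiv_fderiv_symm (he : ContDiffAt ℝ 2 e p) (u y : E) :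
    fderiv ℝ (fderiv ℝ e) p u y = fderiv ℝ (fderiv ℝ e) p y u :=
  (he.isSymmSndFDerivAt (by simp)).eq u y

theorem covariantHessian_symm (he : ContDiffAt ℝ 2 e p)
    (hA : ∀ ξ η, A (e p) ξ η = A (e p) η ξ) (u y : E) :
    covariantHessian A e p u y = covariantHessian A e p y u := by
  rw [covariantHessian_apply, covariantHessian_apply, fderiv_fderiv_symm he, hA]

theorem differentiableAt_pullbackConnection (he : ContDiffAt ℝ 3 e p)
    (hA : DifferentiableAt ℝ A (e p)) : DifferentiableAt ℝ (pullbackConnection A e) p := by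
  have h1 : DifferentiableAt ℝ e p := he.differentiableAt (by simp)
  have h2 : DifferentiableAt ℝ (fderiv ℝ e) p :=
    (he.fderiv_right (m := 2) (by norm_num)).differentiableAt (by simp)
  exact (DifferentiableAt.comp p hA h1).clm_comp h2

theorem differentiableAt_covariantHessian (he : ContDiffAt ℝ 3 e p)
    (hA : DifferentiableAt ℝ A (e p)) : DifferentiableAt ℝ (covariantHessian A e) p := by
  have he2 := he.fderiv_right (m := 2) (by norm_num)
  have h2 : DifferentiableAt ℝ (fderiv ℝ e) p := he2.differentiableAt (by simp)
  have h3 : DifferentiableAt ℝ (fderiv ℝ (fderiv ℝ e)) p :=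
    (he2.fderiv_right (m := 1) (by norm_num)).differentiableAt (by simp)
  exact h3.add ((((ContinuousLinearMap.compL ℝ E V V).flip).differentiableAt.comp p h2).clm_comp
    (differentiableAt_pullbackConnection he hA))

theorem fderiv_pullbackConnection_apply (he : ContDiffAt ℝ 3 e p)
    (hA : DifferentiableAt ℝ A (e p)) (x y : E) (z : V) :
    fderiv ℝ (pullbackConnection A e) p x y z =
      fderiv ℝ A (e p) (fderiv ℝ e p x) (fderiv ℝ e p y) z +
        A (e p) (fderiv ℝ (fderiv ℝ e) p x y) z := by
  have h1 : DifferentiableAt ℝ e p := he.differentiableAt (by simp)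
  have h2 : DifferentiableAt ℝ (fderiv ℝ e) p :=
    (he.fderiv_right (m := 2) (by norm_num)).differentiableAt (by simp)
  have hl := (((differentiableAt_pullbackConnection he hA).hasFDerivAt.clm_apply
    (hasFDerivAt_const y p)).clm_apply (hasFDerivAt_const z p))
  have hr := ((hA.hasFDerivAt.comp p h1.hasFDerivAt).clm_apply
    (h2.hasFDerivAt.clm_apply (hasFDerivAt_const y p))).clm_apply (hasFDerivAt_const z p)
  have := congrArg (fun f => f x) (hl.unique hr)
  simpa [add_comm] using this

theorem fderiv_covariantHessian_apply (he : ContDiffAt ℝ 3 e p)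
    (hA : DifferentiableAt ℝ A (e p)) (x u y : E) :
    fderiv ℝ (covariantHessian A e) p x u y =
      fderiv ℝ (fderiv ℝ (fderiv ℝ e)) p x u y +
        fderiv ℝ (pullbackConnection A e) p x u (fderiv ℝ e p y) +
        A (e p) (fderiv ℝ e p u) (fderiv ℝ (fderiv ℝ e) p x y) := by
  have he2 := he.fderiv_right (m := 2) (by norm_num)
  have h2 : DifferentiableAt ℝ (fderiv ℝ e) p := he2.differentiableAt (by simp)
  have h3 : DifferentiableAt ℝ (fderiv ℝ (fderiv ℝ e)) p :=
    (he2.fderiv_right (m := 1) (by norm_num)).differentiableAt (by simp)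
  have hl := (((differentiableAt_covariantHessian he hA).hasFDerivAt.clm_apply
    (hasFDerivAt_const u p)).clm_apply (hasFDerivAt_const y p))
  have hr := ((h3.hasFDerivAt.clm_apply (hasFDerivAt_const u p)).clm_apply
    (hasFDerivAt_const y p)).add
    ((((differentiableAt_pullbackConnection he hA).hasFDerivAt).clm_apply
      (hasFDerivAt_const u p)).clm_apply (h2.hasFDerivAt.clm_apply (hasFDerivAt_const y p)))
  have := congrArg (fun f => f x) (hl.unique hr)
  simp at this
  rw [this]
  abel

/-- The Ricci identity: at a zero of the covariant Hessian, its derivative is symmetric up to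
curvature. -/
theorem fderiv_covariantHessian_sub (he : ContDiffAt ℝ 3 e p)
    (hA : DifferentiableAt ℝ A (e p)) (h0 : covariantHessian A e p = 0) (x u y : E) :
    fderiv ℝ (covariantHessian A e) p x u y - fderiv ℝ (covariantHessian A e) p u x y =
      curvature A (e p) (fderiv ℝ e p x) (fderiv ℝ e p u) (fderiv ℝ e p y) := by
  have hD : ∀ x y, fderiv ℝ (fderiv ℝ e) p x y =
      - A (e p) (fderiv ℝ e p x) (fderiv ℝ e p y) := fun x y => by
    have := congrArg (fun f => f x y) h0
    rw [covariantHessian_apply] at this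
    exact eq_neg_of_add_eq_zero_left this
  rw [fderiv_covariantHessian_apply he hA, fderiv_covariantHessian_apply he hA,
    fderiv_pullbackConnection_apply he hA, fderiv_pullbackConnection_apply he hA,
    fderiv_fderiv_symm (he.fderiv_right (m := 2) (by norm_num)) x u,
    fderiv_fderiv_symm (he.of_le (by norm_num)) x u, hD x y, hD u y]
  simp [curvature]
  abel

/-- For a map sending rays to geodesics, the derivative of the covariant Hessian at the origin is
determined by the curvature. -/
theorem three_smul_fderiv_covariantHessian {e : E → V} (he : ContDiffAt ℝ 3 e 0)
    (hA : DifferentiableAt ℝ A (e 0)) (h0 : covariantHessian A e 0 = 0)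
    (hsymm : ∀ᶠ p in 𝓝 (0 : E), ∀ u y, covariantHessian A e p u y = covariantHessian A e p y u)
    (hrad : ∀ᶠ p in 𝓝 (0 : E), covariantHessian A e p p p = 0) (x y : E) :
    (3 : ℝ) • fderiv ℝ (covariantHessian A e) 0 x x y =
      curvature A (e 0) (fderiv ℝ e 0 x) (fderiv ℝ e 0 y) (fderiv ℝ e 0 x) := by
  set T := fderiv ℝ (covariantHessian A e) 0 with hT
  have hS : HasFDerivAt (covariantHessian A e) T 0 :=
    (differentiableAt_covariantHessian he hA).hasFDerivAt
  have hTsymm : ∀ w u y, T w u y = T w y u := by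
    intro w u y
    have h1 := (hS.clm_apply (hasFDerivAt_const u 0)).clm_apply (hasFDerivAt_const y 0)
    have h2 := (hS.clm_apply (hasFDerivAt_const y 0)).clm_apply (hasFDerivAt_const u 0)
    have := congrArg (fun f => f w)
      ((h1.congr_of_eventuallyEq (hsymm.mono fun p hp => hp y u)).unique h2)
    simpa using this
  have hTrad : ∀ w, T w w w = 0 := by
    intro w
    have hline : HasDerivAt (fun t : ℝ => t • w) w 0 := by
      simpa using (hasDerivAt_id (0 : ℝ)).smul_const w
    have h0' := (hS.clm_apply (hasFDerivAt_const w 0)).clm_apply (hasFDerivAt_const w 0)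
    have h1 := h0'.comp_hasDerivAt_of_eq (0 : ℝ) hline (zero_smul ℝ w).symm
    have hz : (fun t : ℝ => covariantHessian A e (t • w) w w) =ᶠ[𝓝 0] fun _ => 0 := by
      have hc : Filter.Tendsto (fun t : ℝ => t • w) (𝓝 0) (𝓝 0) := by
        simpa using hline.continuousAt.tendsto
      filter_upwards [hc.eventually hrad] with t ht
      by_cases ht0 : t = 0
      · rw [ht0, zero_smul, h0]; rfl
      · simpa [ht0, -covariantHessian_apply] using ht
    have := (h1.congr_of_eventuallyEq hz.symm).unique (hasDerivAt_const 0 (0 : V))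
    simpa using this
  have hpol : T y x x + (2 : ℝ) • T x x y = 0 := by
    have h1 := hTrad (x + y)
    have h2 := hTrad (x - y)
    have h3 := hTrad x
    have h4 := hTrad y
    simp only [map_add, map_sub, add_apply, sub_apply,
      h3, h4] at h1 h2
    rw [hTsymm x y x] at h1 h2
    rw [hTsymm y y x] at h1 h2
    have h5 := congrArg₂ (· - ·) h1 h2
    have h6 : (2 : ℝ) • (T y x x + (2 : ℝ) • T x x y) = 0 := by
      rw [sub_self] at h5
      rw [← h5]
      module
    exact (smul_eq_zero.1 h6).resolve_left two_ne_zero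
  have hric := fderiv_covariantHessian_sub he hA h0 x y x
  rw [← hT, hTsymm x y x] at hric
  rw [← hric, eq_neg_of_add_eq_zero_left hpol]
  module

/-- The curvature of a metric connection is skew-symmetric. -/
theorem curvature_skew {G : E → V →L[ℝ] V →L[ℝ] ℝ} (he : ContDiffAt ℝ 3 e p)
    (hA : DifferentiableAt ℝ A (e p))
    (hG : ∀ᶠ q in 𝓝 p, HasFDerivAt G (parallelDeriv (G q) (pullbackConnection A e q)) q)
    (x y : E) (z w : V) :
    G p (curvature A (e p) (fderiv ℝ e p x) (fderiv ℝ e p y) z) w +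
      G p z (curvature A (e p) (fderiv ℝ e p x) (fderiv ℝ e p y) w) = 0 := by
  have ha := (differentiableAt_pullbackConnection he hA).hasFDerivAt
  have hGp := hG.self_of_nhds
  set L := fun q => parallelDeriv (G q) (pullbackConnection A e q) with hL
  have hLd : DifferentiableAt ℝ L p := by
    have h1 : DifferentiableAt ℝ (fun q => (G q).flip) p :=
      (ContinuousLinearMap.flipₗᵢ ℝ V V ℝ).differentiableAt.comp p hGp.differentiableAt
    have h0 := hGp.differentiableAt
    have h2 := ha.differentiableAt
    simp only [hL, parallelDeriv]
    fun_prop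
  have hsymm := second_derivative_symmetric_of_eventually hG hLd.hasFDerivAt x y
  have hval : ∀ x y, fderiv ℝ L p x y z w =
      parallelDeriv (G p) (pullbackConnection A e p) x (A (e p) (fderiv ℝ e p y) z) w +
      parallelDeriv (G p) (pullbackConnection A e p) x z (A (e p) (fderiv ℝ e p y) w) +
      G p (fderiv ℝ (pullbackConnection A e) p x y z) w +
      G p z (fderiv ℝ (pullbackConnection A e) p x y w) := by
    intro x y
    have hl := ((hLd.hasFDerivAt.clm_apply (hasFDerivAt_const y p)).clm_apply
      (hasFDerivAt_const z p)).clm_apply (hasFDerivAt_const w p)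
    have haz := (ha.clm_apply (hasFDerivAt_const y p)).clm_apply (hasFDerivAt_const z p)
    have haw := (ha.clm_apply (hasFDerivAt_const y p)).clm_apply (hasFDerivAt_const w p)
    have hr := ((hGp.clm_apply haz).clm_apply (hasFDerivAt_const w p)).add
      ((hGp.clm_apply (hasFDerivAt_const z p)).clm_apply haw)
    have hr' := hr.congr_of_eventuallyEq (f := fun q => L q y z w)
      (Filter.Eventually.of_forall fun q => parallelDeriv_apply _ _ _ _ _)
    have := congrArg (fun f => f x) (hl.unique hr')
    simp at this
    rw [this]
    simp
    ring
  have h := congrArg (fun f => f z w) hsymm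
  simp only [hval, parallelDeriv_apply, pullbackConnection_apply,
    fderiv_pullbackConnection_apply he hA,
    fderiv_fderiv_symm (he.of_le (by norm_num)) y x] at h
  simp only [curvature, map_add, map_sub, add_apply,
    sub_apply, ContinuousLinearMap.comp_apply] at h ⊢
  linarith

end CovariantHessian

section CircleExpansion

variable {E V : Type*} [NormedAddCommGroup E] [NormedSpace ℝ E] [NormedAddCommGroup V]
  [NormedSpace ℝ V] {A : V → V →L[ℝ] V →L[ℝ] V} {e : E → V} {G : E → V →L[ℝ] V →L[ℝ] ℝ}

/-- The directional derivative of the pulled back metric in terms of the covariant Hessian. -/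
theorem hasFDerivAt_pullback_metric {p : E} (he : ContDiffAt ℝ 2 e p)
    (hG : HasFDerivAt G (parallelDeriv (G p) (pullbackConnection A e p)) p)
    (hsymm : ∀ η ζ, G p η ζ = G p ζ η) (y : E) :
    ∃ f' : E →L[ℝ] ℝ,
      HasFDerivAt (fun q => G q (fderiv ℝ e q y) (fderiv ℝ e q y)) f' p ∧
      ∀ x, f' x = 2 * G p (covariantHessian A e p x y) (fderiv ℝ e p y) := by
  have h2 : DifferentiableAt ℝ (fderiv ℝ e) p :=
    (he.fderiv_right (m := 1) (by norm_num)).differentiableAt (by simp)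
  have hy := h2.hasFDerivAt.clm_apply (hasFDerivAt_const y p)
  refine ⟨_, (hG.clm_apply hy).clm_apply hy, fun x => ?_⟩
  simp [hsymm (fderiv ℝ e p y)]
  ring

/-- Uniform second order expansion of the pulled back metric along the rays. -/
theorem pullback_metric_expansion (he : ContDiffAt ℝ 3 e 0)
    (hA : DifferentiableAt ℝ A (e 0)) (h0 : covariantHessian A e 0 = 0)
    (hG : ∀ᶠ q in 𝓝 (0 : E), HasFDerivAt G (parallelDeriv (G q) (pullbackConnection A e q)) q)
    (hsymm : ∀ᶠ q in 𝓝 (0 : E), ∀ η ζ, G q η ζ = G q ζ η) (c : ℝ) {ε : ℝ} (hε : 0 < ε) :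
    ∃ δ > 0, ∀ x y : E, ‖x‖ = 1 → ‖y‖ = 1 → G 0 (fderiv ℝ e 0 y) (fderiv ℝ e 0 y) = 1 →
      G 0 (fderiv ℝ (covariantHessian A e) 0 x x y) (fderiv ℝ e 0 y) = c →
      ∀ t ∈ Set.Ico (0 : ℝ) δ,
        |G (t • x) (fderiv ℝ e (t • x) y) (fderiv ℝ e (t • x) y) - (1 + c * t ^ 2)| ≤
          ε * t ^ 2 := by
  have h2 : DifferentiableAt ℝ (fderiv ℝ e) 0 :=
    (he.fderiv_right (m := 2) (by norm_num)).differentiableAt (by simp)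
  have hS := (differentiableAt_covariantHessian he hA)
  have hG0 := hG.self_of_nhds
  set N : E → E →L[ℝ] E →L[ℝ] E →L[ℝ] ℝ := fun p =>
    (ContinuousLinearMap.compL ℝ E V (E →L[ℝ] ℝ)
      (((ContinuousLinearMap.compL ℝ E V ℝ).flip (fderiv ℝ e p)).comp (G p))).comp
      (covariantHessian A e p) with hN
  have hNapply : ∀ p u y z, N p u y z = G p (covariantHessian A e p u y) (fderiv ℝ e p z) :=
    fun p u y z => rfl
  have hNd : DifferentiableAt ℝ N 0 := by
    have h1 := hG0.differentiableAt
    simp only [hN]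
    fun_prop
  have hN' : ∀ x u y z, fderiv ℝ N 0 x u y z =
      G 0 (fderiv ℝ (covariantHessian A e) 0 x u y) (fderiv ℝ e 0 z) := by
    intro x u y z
    have hl := ((hNd.hasFDerivAt.clm_apply (hasFDerivAt_const u 0)).clm_apply
      (hasFDerivAt_const y 0)).clm_apply (hasFDerivAt_const z 0)
    have hr := (hG0.clm_apply ((hS.hasFDerivAt.clm_apply (hasFDerivAt_const u 0)).clm_apply
      (hasFDerivAt_const y 0))).clm_apply (h2.hasFDerivAt.clm_apply (hasFDerivAt_const z 0))
    have := congrArg (fun f => f x) (hl.unique hr)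
    simpa [h0, -covariantHessian_apply] using this
  have hN0 : N 0 = 0 := by
    simp only [hN, h0]
    exact ContinuousLinearMap.comp_zero _
  have hlo : ∀ᶠ p in 𝓝 (0 : E), ‖N p - fderiv ℝ N 0 p‖ ≤ ε / 2 * ‖p‖ := by
    have := (hasFDerivAt_iff_isLittleO.1 hNd.hasFDerivAt)
    rw [Asymptotics.isLittleO_iff] at this
    simpa [hN0] using this (half_pos hε)
  have he' : ∀ᶠ p in 𝓝 (0 : E), ContDiffAt ℝ 2 e p :=
    (he.of_le (m := 2) (by norm_num)).eventually (by simp)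
  obtain ⟨δ, hδ, hball⟩ := Metric.eventually_nhds_iff_ball.1
    (hG.and (hsymm.and (hlo.and he')))
  refine ⟨δ, hδ, fun x y hx hy hy1 hc t ht => ?_⟩
  have hder : ∀ s ∈ Set.Icc (0 : ℝ) t, HasDerivWithinAt
      (fun s : ℝ => G (s • x) (fderiv ℝ e (s • x) y) (fderiv ℝ e (s • x) y) - (1 + c * s ^ 2))
      (2 * (N (s • x) x y y - c * s)) (Set.Icc 0 t) s := by
    intro s hs
    have hsx : s • x ∈ Metric.ball (0 : E) δ := by
      rw [mem_ball_zero_iff, norm_smul, hx, mul_one, Real.norm_of_nonneg hs.1]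
      exact hs.2.trans_lt ht.2
    obtain ⟨hGs, hss, -, hes⟩ := hball _ hsx
    obtain ⟨f', hf', hf'x⟩ := hasFDerivAt_pullback_metric hes hGs hss y
    have hline : HasDerivAt (fun t : ℝ => t • x) x s := by
      simpa using (hasDerivAt_id s).smul_const x
    have h3 := hf'.comp_hasDerivAt s hline
    have h4 : HasDerivAt (fun s : ℝ => 1 + c * s ^ 2) (2 * (c * s)) s := by
      refine (((hasDerivAt_pow 2 s).const_mul c).const_add 1).congr_deriv ?_
      simp
      ring
    refine ((h3.sub h4).congr_deriv ?_).hasDerivWithinAt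
    rw [hf'x, hNapply]
    ring
  have hbound : ∀ s ∈ Set.Icc (0 : ℝ) t, ‖2 * (N (s • x) x y y - c * s)‖ ≤ ε * t := by
    intro s hs
    have hsn : ‖s • x‖ = s := by rw [norm_smul, hx, mul_one, Real.norm_of_nonneg hs.1]
    have hsx : s • x ∈ Metric.ball (0 : E) δ := by
      rw [mem_ball_zero_iff, hsn]
      exact hs.2.trans_lt ht.2
    obtain ⟨-, -, hls, -⟩ := hball _ hsx
    have hcs : c * s = fderiv ℝ N 0 (s • x) x y y := by
      rw [map_smul]
      change _ = s * fderiv ℝ N 0 x x y y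
      rw [hN', hc, mul_comm]
    rw [hcs]
    have h5 : ‖(N (s • x) - fderiv ℝ N 0 (s • x)) x y y‖ ≤
        ‖N (s • x) - fderiv ℝ N 0 (s • x)‖ * ‖x‖ * ‖y‖ * ‖y‖ := by
      refine (ContinuousLinearMap.le_opNorm₂ _ _ _).trans ?_
      gcongr
      exact ContinuousLinearMap.le_opNorm _ _
    rw [hx, hy, mul_one, mul_one, mul_one] at h5
    rw [norm_mul, Real.norm_ofNat]
    rw [hsn] at hls
    change 2 * ‖(N (s • x) - fderiv ℝ N 0 (s • x)) x y y‖ ≤ _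
    nlinarith [hs.2]
  have key := (convex_Icc (0 : ℝ) t).norm_image_sub_le_of_norm_hasDerivWithin_le hder hbound
    (Set.left_mem_Icc.2 ht.1) (Set.right_mem_Icc.2 ht.1)
  simp only [zero_smul, hy1] at key
  rw [sub_zero, Real.norm_of_nonneg ht.1] at key
  simpa [pow_two, mul_assoc] using key

/-- Expansion of the square root of a function with a second order expansion. -/
theorem sqrt_expansion (k : ℝ) {ε : ℝ} (hε : 0 < ε) :
    ∃ δ > 0, ∀ t ∈ Set.Ioo (0 : ℝ) δ, ∀ f : ℝ, 0 ≤ f → |f - (1 + 2 * k * t ^ 2)| ≤ ε * t ^ 2 →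
      |√(t ^ 2 * f) - (t + k * t ^ 3)| ≤ 3 * ε * t ^ 3 := by
  have h1 : ∀ᶠ t in 𝓝 (0 : ℝ), 1 / 2 < 1 + k * t ^ 2 := by
    have : ContinuousAt (fun t : ℝ => 1 + k * t ^ 2) 0 := by fun_prop
    exact this.eventually (lt_mem_nhds (by norm_num))
  have h2 : ∀ᶠ t in 𝓝 (0 : ℝ), k ^ 2 * t ^ 2 < ε / 2 := by
    have : ContinuousAt (fun t : ℝ => k ^ 2 * t ^ 2) 0 := by fun_prop
    exact this.eventually (gt_mem_nhds (by simpa using hε))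
  obtain ⟨δ, hδ, hball⟩ := Metric.eventually_nhds_iff_ball.1 (h1.and h2)
  refine ⟨δ, hδ, fun t ht f hf hft => ?_⟩
  obtain ⟨hb, hk⟩ := hball t (by
    rw [mem_ball_zero_iff, Real.norm_of_nonneg ht.1.le]; exact ht.2)
  have ht0 := ht.1
  set b := 1 + k * t ^ 2 with hbdef
  have hsq : |√f - b| * (√f + b) = |f - b ^ 2| := by
    rw [← abs_of_pos (show 0 < √f + b by positivity), ← abs_mul]
    congr 1
    nlinarith [Real.sq_sqrt hf]
  have hfb : |f - b ^ 2| ≤ (3 / 2) * ε * t ^ 2 := by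
    have : f - b ^ 2 = (f - (1 + 2 * k * t ^ 2)) - (k ^ 2 * t ^ 2) * t ^ 2 := by
      rw [hbdef]; ring
    rw [this]
    refine (abs_sub _ _).trans ?_
    rw [abs_of_nonneg (show 0 ≤ (k ^ 2 * t ^ 2) * t ^ 2 by positivity)]
    nlinarith [sq_nonneg t]
  have hmain : |√f - b| ≤ 3 * ε * t ^ 2 := by
    have h3 : |√f - b| * (1 / 2) ≤ |√f - b| * (√f + b) := by
      gcongr
      linarith [Real.sqrt_nonneg f]
    linarith
  rw [Real.sqrt_mul (sq_nonneg t), Real.sqrt_sq ht0.le,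
    show t * √f - (t + k * t ^ 3) = t * (√f - b) by rw [hbdef]; ring, abs_mul, abs_of_pos ht0]
  calc t * |√f - b| ≤ t * (3 * ε * t ^ 2) := by gcongr
    _ = _ := by ring

end CircleExpansion

section Circles

theorem circPt_eq_smul (r θ : ℝ) : circPt r θ = r • circPt 1 θ := by
  simp [circPt, smul_smul]

theorem circTang_eq_smul (r θ : ℝ) : circTang r θ = r • circTang 1 θ := by
  simp [circTang, smul_smul]

theorem norm_circPt_one (θ : ℝ) : ‖circPt 1 θ‖ = 1 := by
  simp [circPt, EuclideanSpace.norm_eq]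

theorem norm_circTang_one (θ : ℝ) : ‖circTang 1 θ‖ = 1 := by
  simp [circTang, EuclideanSpace.norm_eq]

end Circles

section GeodesicPolar

variable {V : Type*} [NormedAddCommGroup V] [NormedSpace ℝ V]
  {A : V → V →L[ℝ] V →L[ℝ] V} {e : EuclideanSpace ℝ (Fin 2) → V}

/-- The curvature endomorphism is unchanged under rotation of the frame. -/
theorem curvature_circ (v : V) (D : EuclideanSpace ℝ (Fin 2) →L[ℝ] V) (θ : ℝ) :
    curvature A v (D (circPt 1 θ)) (D (circTang 1 θ)) =
      curvature A v (D (EuclideanSpace.single (0 : Fin 2) (1 : ℝ)))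
        (D (EuclideanSpace.single (1 : Fin 2) (1 : ℝ))) := by
  have hcs := Real.cos_sq_add_sin_sq θ
  ext z
  simp only [curvature, circPt, circTang, one_mul, map_add, map_smul, add_apply, sub_apply,
    smul_apply, ContinuousLinearMap.comp_apply]
  set ξ := D (EuclideanSpace.single (0 : Fin 2) (1 : ℝ))
  set η := D (EuclideanSpace.single (1 : Fin 2) (1 : ℝ))
  calc _ = (Real.cos θ ^ 2 + Real.sin θ ^ 2) • (fderiv ℝ A v ξ η z - fderiv ℝ A v η ξ z
        + A v ξ (A v η z) - A v η (A v ξ z)) := by module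
    _ = _ := by rw [hcs, one_smul]

/-- The sectional curvature does not depend on the orthonormal frame. -/
theorem bilin_circ_of_skew (B : V →L[ℝ] V →L[ℝ] ℝ) (R : V →L[ℝ] V)
    (hsymm : ∀ η ζ, B η ζ = B ζ η) (hskew : ∀ z w, B (R z) w + B z (R w) = 0)
    (D : EuclideanSpace ℝ (Fin 2) →L[ℝ] V) (θ : ℝ) :
    B (R (D (circPt 1 θ))) (D (circTang 1 θ)) =
      - B (R (D (EuclideanSpace.single (1 : Fin 2) (1 : ℝ))))
        (D (EuclideanSpace.single (0 : Fin 2) (1 : ℝ))) := by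
  have hcs := Real.cos_sq_add_sin_sq θ
  simp only [circPt, circTang, one_mul, map_add, map_smul, add_apply, smul_apply, smul_eq_mul]
  set ξ := D (EuclideanSpace.single (0 : Fin 2) (1 : ℝ))
  set η := D (EuclideanSpace.single (1 : Fin 2) (1 : ℝ))
  have h1 := hskew ξ ξ
  have h2 := hskew η η
  have h3 := hskew ξ η
  rw [hsymm ξ (R ξ)] at h1
  rw [hsymm η (R η)] at h2
  rw [hsymm ξ (R η)] at h3
  have h4 : B (R ξ) ξ = 0 := by linarith
  have h5 : B (R η) η = 0 := by linarith
  have h6 : B (R ξ) η = - B (R η) ξ := by linarith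
  rw [h4, h5, h6]
  linear_combination (-(B (R η) ξ)) * hcs

/-- Velocity and acceleration of the image of a ray. -/
theorem deriv_comp_ray {r₀ : ℝ} (he : ContDiffOn ℝ 2 e (Metric.ball 0 r₀))
    {ρ : EuclideanSpace ℝ (Fin 2)} (hρ : ‖ρ‖ = 1) {t : ℝ} (ht : |t| < r₀) :
    deriv (fun s : ℝ => e (s • ρ)) t = fderiv ℝ e (t • ρ) ρ ∧
      deriv (deriv fun s : ℝ => e (s • ρ)) t = fderiv ℝ (fderiv ℝ e) (t • ρ) ρ ρ := by
  have hmem : ∀ s : ℝ, |s| < r₀ → s • ρ ∈ Metric.ball (0 : EuclideanSpace ℝ (Fin 2)) r₀ := by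
    intro s hs
    simpa [norm_smul, hρ] using hs
  have hat : ∀ s : ℝ, |s| < r₀ → ContDiffAt ℝ 2 e (s • ρ) := fun s hs =>
    he.contDiffAt (Metric.isOpen_ball.mem_nhds (hmem s hs))
  have hline : ∀ s : ℝ, HasDerivAt (fun t : ℝ => t • ρ) ρ s := fun s => by
    simpa using (hasDerivAt_id s).smul_const ρ
  have h1 : ∀ s : ℝ, |s| < r₀ → deriv (fun s : ℝ => e (s • ρ)) s = fderiv ℝ e (s • ρ) ρ :=
    fun s hs => (((hat s hs).differentiableAt (by simp)).hasFDerivAt.comp_hasDerivAt s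
      (hline s)).deriv
  refine ⟨h1 t ht, ?_⟩
  have hev : (deriv fun s : ℝ => e (s • ρ)) =ᶠ[𝓝 t] fun s => fderiv ℝ e (s • ρ) ρ := by
    filter_upwards [(continuous_abs.tendsto t).eventually (gt_mem_nhds ht)] with s hs
    exact h1 s hs
  rw [hev.deriv_eq]
  have h2 : DifferentiableAt ℝ (fderiv ℝ e) (t • ρ) :=
    ((hat t ht).fderiv_right (m := 1) (by norm_num)).differentiableAt (by simp)
  have h3 := (h2.hasFDerivAt.clm_apply (hasFDerivAt_const ρ (t • ρ))).comp_hasDerivAt t (hline t)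
  refine h3.deriv.trans ?_
  simp

/-- A symmetric bilinear form on the plane that is `1` on unit vectors is the standard inner
product on the standard basis. -/
theorem orthonormal_of_unit (B : V →L[ℝ] V →L[ℝ] ℝ) (hsymm : ∀ η ζ, B η ζ = B ζ η)
    (D : EuclideanSpace ℝ (Fin 2) →L[ℝ] V)
    (hunit : ∀ ρ : EuclideanSpace ℝ (Fin 2), ‖ρ‖ = 1 → B (D ρ) (D ρ) = 1) :
    B (D (EuclideanSpace.single (0 : Fin 2) (1 : ℝ)))
      (D (EuclideanSpace.single (1 : Fin 2) (1 : ℝ))) = 0 := by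
  have h0 := hunit (EuclideanSpace.single (0 : Fin 2) (1 : ℝ)) (by simp)
  have h1 := hunit (EuclideanSpace.single (1 : Fin 2) (1 : ℝ)) (by simp)
  have h2 := hunit _ (norm_circPt_one (Real.pi / 4))
  simp only [circPt, one_mul, map_add, map_smul, add_apply, smul_apply, smul_eq_mul, h0, h1,
    hsymm (D (EuclideanSpace.single (1 : Fin 2) (1 : ℝ))), Real.cos_pi_div_four,
    Real.sin_pi_div_four] at h2
  have h3 : √(2 : ℝ) * √2 = 2 := Real.mul_self_sqrt (by norm_num)
  nlinarith

/-- Integration of a uniform expansion over the circle. -/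
theorem integral_expansion_isLittleO (F : ℝ → ℝ → ℝ) (k : ℝ)
    (hcont : ∀ᶠ r in 𝓝[>] (0 : ℝ), Continuous (F r))
    (hF : ∀ ε > 0, ∀ᶠ r in 𝓝[>] (0 : ℝ), ∀ θ, |F r θ - (r + k * r ^ 3)| ≤ ε * r ^ 3) :
    (fun r : ℝ => (∫ θ in (0 : ℝ)..(2 * Real.pi), F r θ) -
      (2 * Real.pi * r + 2 * Real.pi * k * r ^ 3)) =o[𝓝[>] (0 : ℝ)] fun r : ℝ => r ^ 3 := by
  rw [Asymptotics.isLittleO_iff]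
  intro c hc
  have hpi := Real.pi_pos
  filter_upwards [hcont, hF (c / (2 * Real.pi)) (by positivity), self_mem_nhdsWithin]
    with r hr hFr hr0
  have hr0 : 0 < r := hr0
  have heq : (∫ θ in (0 : ℝ)..(2 * Real.pi), F r θ) -
      (2 * Real.pi * r + 2 * Real.pi * k * r ^ 3) =
      ∫ θ in (0 : ℝ)..(2 * Real.pi), (F r θ - (r + k * r ^ 3)) := by
    rw [intervalIntegral.integral_sub (hr.intervalIntegrable _ _) (by simp)]
    simp
    ring
  rw [heq]
  refine (intervalIntegral.norm_integral_le_of_norm_le_const fun θ _ => hFr θ).trans_eq ?_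
  rw [sub_zero, abs_of_pos (by positivity), Real.norm_of_nonneg (by positivity)]
  field_simp

end GeodesicPolar

/-- Bertrand–Puiseux expansion of the length of geodesic circles. -/
theorem geodesic_circle_expansion {V : Type*} [NormedAddCommGroup V] [NormedSpace ℝ V]
    (Ω : Set V) (hΩ : IsOpen Ω)
    (g : V → V →L[ℝ] V →L[ℝ] ℝ) (hg : IsRiemannianMetric Ω g)
    (A : V → V →L[ℝ] V →L[ℝ] V) (hA : ContDiffOn ℝ 1 A Ω) (hALC : IsLeviCivita Ω g A)
    (r₀ : ℝ) (hr₀ : 0 < r₀)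
    (e : EuclideanSpace ℝ (Fin 2) → V)
    (he : ContDiffOn ℝ 3 e (Metric.ball 0 r₀))
    (hemem : ∀ p ∈ Metric.ball (0 : EuclideanSpace ℝ (Fin 2)) r₀, e p ∈ Ω)
    (hgeo : ∀ ρ : EuclideanSpace ℝ (Fin 2), ‖ρ‖ = 1 → ∀ t ∈ Set.Ico (0 : ℝ) r₀,
      deriv (deriv fun s : ℝ => e (s • ρ)) t
        + A (e (t • ρ)) (deriv (fun s : ℝ => e (s • ρ)) t)
            (deriv (fun s : ℝ => e (s • ρ)) t) = 0)
    (hunit : ∀ ρ : EuclideanSpace ℝ (Fin 2), ‖ρ‖ = 1 →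
      g (e 0) (fderiv ℝ e 0 ρ) (fderiv ℝ e 0 ρ) = 1) :
    (fun r : ℝ =>
        (∫ θ in (0 : ℝ)..(2 * Real.pi),
          Real.sqrt (g (e (circPt r θ)) (fderiv ℝ e (circPt r θ) (circTang r θ))
            (fderiv ℝ e (circPt r θ) (circTang r θ)))) -
        (2 * Real.pi * r -
          Real.pi *
            (g (e 0)
              (curvature A (e 0) (fderiv ℝ e 0 (EuclideanSpace.single (0 : Fin 2) (1 : ℝ)))
                  (fderiv ℝ e 0 (EuclideanSpace.single (1 : Fin 2) (1 : ℝ)))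
                (fderiv ℝ e 0 (EuclideanSpace.single (1 : Fin 2) (1 : ℝ))))
              (fderiv ℝ e 0 (EuclideanSpace.single (0 : Fin 2) (1 : ℝ)))) / 3 * r ^ 3))
      =o[𝓝[>] (0 : ℝ)] fun r : ℝ => r ^ 3 := by
  set G : EuclideanSpace ℝ (Fin 2) → V →L[ℝ] V →L[ℝ] ℝ := fun p => g (e p) with hGdef
  have hball : Metric.ball (0 : EuclideanSpace ℝ (Fin 2)) r₀ ∈ 𝓝 0 := Metric.ball_mem_nhds _ hr₀
  have he3 : ∀ p ∈ Metric.ball (0 : EuclideanSpace ℝ (Fin 2)) r₀, ContDiffAt ℝ 3 e p :=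
    fun p hp => he.contDiffAt (Metric.isOpen_ball.mem_nhds hp)
  have hAd : ∀ p ∈ Metric.ball (0 : EuclideanSpace ℝ (Fin 2)) r₀,
      DifferentiableAt ℝ A (e p) := fun p hp =>
    (hA.contDiffAt (hΩ.mem_nhds (hemem p hp))).differentiableAt (by simp)
  have h00 : (0 : EuclideanSpace ℝ (Fin 2)) ∈ Metric.ball 0 r₀ := Metric.mem_ball_self hr₀
  have hG : ∀ᶠ q in 𝓝 0, HasFDerivAt G (parallelDeriv (G q) (pullbackConnection A e q)) q := by
    refine eventually_hasFDerivAt_of_weak_parallel hball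
      (fun p hp => (differentiableAt_pullbackConnection (he3 p hp) (hAd p hp)).continuousAt)
      fun p hp η ζ => ?_
    have h1 := (hALC.2 (e p) (hemem p hp) η ζ).comp p
      ((he3 p hp).differentiableAt (by simp)).hasFDerivAt
    refine h1.congr_fderiv ?_
    ext u
    simp [hGdef]
  have hGsymm : ∀ p ∈ Metric.ball (0 : EuclideanSpace ℝ (Fin 2)) r₀, ∀ η ζ, G p η ζ = G p ζ η :=
    fun p hp => hg.1 (e p) (hemem p hp)
  have hSsymm : ∀ p ∈ Metric.ball (0 : EuclideanSpace ℝ (Fin 2)) r₀, ∀ u y,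
      covariantHessian A e p u y = covariantHessian A e p y u := fun p hp =>
    covariantHessian_symm ((he3 p hp).of_le (by norm_num)) (hALC.1 (e p) (hemem p hp))
  have hSunit : ∀ ρ : EuclideanSpace ℝ (Fin 2), ‖ρ‖ = 1 → ∀ t ∈ Set.Ico (0 : ℝ) r₀,
      covariantHessian A e (t • ρ) ρ ρ = 0 := by
    intro ρ hρ t ht
    obtain ⟨h1, h2⟩ := deriv_comp_ray (he.of_le (by norm_num)) hρ
      (show |t| < r₀ by rw [abs_of_nonneg ht.1]; exact ht.2)
    have := hgeo ρ hρ t ht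
    rwa [h1, h2] at this
  have hnormal : ∀ p : EuclideanSpace ℝ (Fin 2), p ≠ 0 → ‖‖p‖⁻¹ • p‖ = 1 ∧
      ‖p‖ • (‖p‖⁻¹ • p) = p := fun p hp =>
    ⟨norm_smul_inv_norm' (𝕜 := ℝ) zero_le_one hp |> fun h => by simpa using h,
      smul_inv_smul₀ (norm_ne_zero_iff.2 hp) p⟩
  have hS0diag : ∀ w, covariantHessian A e 0 w w = 0 := by
    intro w
    by_cases hw : w = 0
    · rw [hw, map_zero]
    obtain ⟨h1, -⟩ := hnormal w hw
    have h3 := hSunit _ h1 0 ⟨le_rfl, hr₀⟩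
    rw [zero_smul] at h3
    simp only [map_smul, smul_apply] at h3
    simpa [hw, -covariantHessian_apply] using h3
  have hS0 : covariantHessian A e 0 = 0 := by
    refine ContinuousLinearMap.ext fun u => ContinuousLinearMap.ext fun y => ?_
    have h1 := hS0diag (u + y)
    simp only [map_add, add_apply, hS0diag, hSsymm 0 h00 y u, zero_add, add_zero] at h1
    have h2 : (2 : ℝ) • covariantHessian A e 0 u y = 0 := by rw [two_smul]; exact h1
    exact (smul_eq_zero.1 h2).resolve_left two_ne_zero
  have hrad : ∀ p ∈ Metric.ball (0 : EuclideanSpace ℝ (Fin 2)) r₀,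
      covariantHessian A e p p p = 0 := by
    intro p hp
    by_cases hp0 : p = 0
    · rw [hp0, map_zero]
    obtain ⟨h1, h2⟩ := hnormal p hp0
    have h3 := hSunit _ h1 ‖p‖ ⟨norm_nonneg p, mem_ball_zero_iff.1 hp⟩
    rw [h2] at h3
    simp only [map_smul, smul_apply] at h3
    simpa [hp0, -covariantHessian_apply] using h3
  set K := g (e 0)
    (curvature A (e 0) (fderiv ℝ e 0 (EuclideanSpace.single (0 : Fin 2) (1 : ℝ)))
        (fderiv ℝ e 0 (EuclideanSpace.single (1 : Fin 2) (1 : ℝ)))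
      (fderiv ℝ e 0 (EuclideanSpace.single (1 : Fin 2) (1 : ℝ))))
    (fderiv ℝ e 0 (EuclideanSpace.single (0 : Fin 2) (1 : ℝ))) with hK
  have hT : ∀ θ, G 0 (fderiv ℝ (covariantHessian A e) 0 (circPt 1 θ) (circPt 1 θ) (circTang 1 θ))
      (fderiv ℝ e 0 (circTang 1 θ)) = 2 * (-K / 6) := by
    intro θ
    have h1 := three_smul_fderiv_covariantHessian (he3 0 h00) (hAd 0 h00) hS0
      (Filter.mem_of_superset hball hSsymm) (Filter.mem_of_superset hball hrad)
      (circPt 1 θ) (circTang 1 θ)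
    rw [curvature_circ] at h1
    have h2 := bilin_circ_of_skew (G 0) _ (hGsymm 0 h00)
      (curvature_skew (he3 0 h00) (hAd 0 h00) hG
        (EuclideanSpace.single (0 : Fin 2) (1 : ℝ)) (EuclideanSpace.single (1 : Fin 2) (1 : ℝ)))
      (fderiv ℝ e 0) θ
    rw [← h1, map_smul, smul_apply, smul_eq_mul] at h2
    linarith
  have hcirc : ∀ r ∈ Set.Ioo 0 r₀, ∀ θ,
      circPt r θ ∈ Metric.ball (0 : EuclideanSpace ℝ (Fin 2)) r₀ := by
    intro r hr θ
    rw [circPt_eq_smul, mem_ball_zero_iff, norm_smul, norm_circPt_one, mul_one,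
      Real.norm_of_nonneg hr.1.le]
    exact hr.2
  have hsmall : ∀ δ > 0, ∀ᶠ r in 𝓝[>] (0 : ℝ), r ∈ Set.Ioo 0 δ := fun δ hδ =>
    Ioo_mem_nhdsGT hδ
  have key := integral_expansion_isLittleO
    (fun r θ => √(g (e (circPt r θ)) (fderiv ℝ e (circPt r θ) (circTang r θ))
      (fderiv ℝ e (circPt r θ) (circTang r θ)))) (-K / 6) ?_ ?_
  · refine key.congr_left fun r => ?_
    ring
  · obtain ⟨δ, hδ, hball'⟩ := Metric.eventually_nhds_iff_ball.1 hG
    filter_upwards [hsmall r₀ hr₀, hsmall δ hδ] with r hr hrδ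
    have hc1 : Continuous (circPt r) := by unfold circPt; fun_prop
    have hc2 : Continuous (circTang r) := by unfold circTang; fun_prop
    have hGc : Continuous fun θ => G (circPt r θ) := by
      rw [continuous_iff_continuousAt]
      intro θ
      refine ContinuousAt.comp (f := circPt r) (g := G) ?_ hc1.continuousAt
      refine (hball' _ ?_).continuousAt
      rw [circPt_eq_smul, mem_ball_zero_iff, norm_smul, norm_circPt_one, mul_one,
        Real.norm_of_nonneg hr.1.le]
      exact hrδ.2
    have hDc : Continuous fun θ => fderiv ℝ e (circPt r θ) := by
      rw [continuous_iff_continuousAt]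
      intro θ
      refine ContinuousAt.comp (f := circPt r) (g := fderiv ℝ e) ?_ hc1.continuousAt
      exact ((he3 _ (hcirc r hr θ)).fderiv_right (m := 2) (by norm_num)).continuousAt
    exact Real.continuous_sqrt.comp ((hGc.clm_apply (hDc.clm_apply hc2)).clm_apply
      (hDc.clm_apply hc2))
  · intro ε hε
    obtain ⟨δ, hδ, h1⟩ := pullback_metric_expansion (he3 0 h00) (hAd 0 h00) hS0 hG
      (Filter.mem_of_superset hball hGsymm) (2 * (-K / 6)) (ε := ε / 3) (by positivity)
    obtain ⟨δ', hδ', h2⟩ := sqrt_expansion (-K / 6) (ε := ε / 3) (by positivity)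
    filter_upwards [hsmall δ hδ, hsmall δ' hδ', hsmall r₀ hr₀] with r hr hr' hr'' θ
    have h3 := h1 (circPt 1 θ) (circTang 1 θ) (norm_circPt_one θ) (norm_circTang_one θ)
      (hunit _ (norm_circTang_one θ)) (hT θ) r ⟨hr.1.le, hr.2⟩
    rw [← circPt_eq_smul] at h3
    have h4 := h2 r hr' _ ?_ h3
    · have h5 : g (e (circPt r θ)) (fderiv ℝ e (circPt r θ) (circTang r θ))
          (fderiv ℝ e (circPt r θ) (circTang r θ)) = r ^ 2 *
          G (circPt r θ) (fderiv ℝ e (circPt r θ) (circTang 1 θ))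
            (fderiv ℝ e (circPt r θ) (circTang 1 θ)) := by
        rw [circTang_eq_smul r θ]
        simp [hGdef]
        ring
      rw [h5]
      refine h4.trans_eq ?_
      ring
    · by_cases hz : fderiv ℝ e (circPt r θ) (circTang 1 θ) = 0
      · rw [hz]; simp
      · exact (hg.2 _ (hemem _ (hcirc r hr'' θ)) _ hz).le

end GeodesicCircles

/-- Bertrand–Puiseux.  Let `A` be a `C³` Levi-Civita connection form for `g`
on `Ω`, `Δ ⊆ ℝ²` the open disc of radius `r₀ > 0` around `0`, and `e : Δ → Ω` a `C⁵` map whose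
restriction to each radius is a unit speed geodesic.  With `v = e 0`, `ξ = ∂₁e(0)`,
`η = ∂₂e(0)` and `K = g_v(R(v)(ξ, η)η, ξ)` the sectional curvature, the vectors `ξ, η` are
`g_v`-orthonormal and the length of the geodesic circle of radius `r` satisfies
`L(r) = 2πr − (πK/3) r³ + o(r³)` as `r → 0⁺`. -/
theorem statement18 {V : Type*} [NormedAddCommGroup V] [NormedSpace ℝ V]
    (Ω : Set V) (hΩ : IsOpen Ω)
    (g : V → V →L[ℝ] V →L[ℝ] ℝ) (hg : IsRiemannianMetric Ω g)
    (A : V → V →L[ℝ] V →L[ℝ] V) (hA3 : ContDiffOn ℝ 3 A Ω) (hALC : IsLeviCivita Ω g A)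
    (r₀ : ℝ) (hr₀ : 0 < r₀)
    (e : EuclideanSpace ℝ (Fin 2) → V)
    (he : ContDiffOn ℝ 5 e (Metric.ball 0 r₀))
    (hemem : ∀ p ∈ Metric.ball (0 : EuclideanSpace ℝ (Fin 2)) r₀, e p ∈ Ω)
    (hgeo : ∀ ρ : EuclideanSpace ℝ (Fin 2), ‖ρ‖ = 1 → ∀ t ∈ Set.Ico (0 : ℝ) r₀,
      deriv (deriv fun s : ℝ => e (s • ρ)) t
        + A (e (t • ρ)) (deriv (fun s : ℝ => e (s • ρ)) t)
            (deriv (fun s : ℝ => e (s • ρ)) t) = 0)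
    (hunit : ∀ ρ : EuclideanSpace ℝ (Fin 2), ‖ρ‖ = 1 → ∀ t ∈ Set.Ico (0 : ℝ) r₀,
      g (e (t • ρ)) (deriv (fun s : ℝ => e (s • ρ)) t)
        (deriv (fun s : ℝ => e (s • ρ)) t) = 1) :
    g (e 0) (fderiv ℝ e 0 (EuclideanSpace.single (0 : Fin 2) (1 : ℝ)))
        (fderiv ℝ e 0 (EuclideanSpace.single (0 : Fin 2) (1 : ℝ))) = 1 ∧
    g (e 0) (fderiv ℝ e 0 (EuclideanSpace.single (1 : Fin 2) (1 : ℝ)))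
        (fderiv ℝ e 0 (EuclideanSpace.single (1 : Fin 2) (1 : ℝ))) = 1 ∧
    g (e 0) (fderiv ℝ e 0 (EuclideanSpace.single (0 : Fin 2) (1 : ℝ)))
        (fderiv ℝ e 0 (EuclideanSpace.single (1 : Fin 2) (1 : ℝ))) = 0 ∧
    (fun r : ℝ =>
        (∫ θ in (0 : ℝ)..(2 * Real.pi),
          Real.sqrt (g (e (circPt r θ)) (fderiv ℝ e (circPt r θ) (circTang r θ))
            (fderiv ℝ e (circPt r θ) (circTang r θ)))) -
        (2 * Real.pi * r -
          Real.pi *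
            (g (e 0)
              (curvature A (e 0) (fderiv ℝ e 0 (EuclideanSpace.single (0 : Fin 2) (1 : ℝ)))
                  (fderiv ℝ e 0 (EuclideanSpace.single (1 : Fin 2) (1 : ℝ)))
                (fderiv ℝ e 0 (EuclideanSpace.single (1 : Fin 2) (1 : ℝ))))
              (fderiv ℝ e 0 (EuclideanSpace.single (0 : Fin 2) (1 : ℝ)))) / 3 * r ^ 3))
      =o[𝓝[>] (0 : ℝ)] fun r : ℝ => r ^ 3 := by
  have hunit0 : ∀ ρ : EuclideanSpace ℝ (Fin 2), ‖ρ‖ = 1 →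
      g (e 0) (fderiv ℝ e 0 ρ) (fderiv ℝ e 0 ρ) = 1 := by
    intro ρ hρ
    have h := hunit ρ hρ 0 ⟨le_rfl, hr₀⟩
    rw [(deriv_comp_ray (he.of_le (by norm_num)) hρ (by simpa using hr₀)).1, zero_smul] at h
    exact h
  exact ⟨hunit0 _ (by simp), hunit0 _ (by simp),
    orthonormal_of_unit (g (e 0)) (hg.1 _ (hemem 0 (Metric.mem_ball_self hr₀))) _ hunit0,
    geodesic_circle_expansion Ω hΩ g hg A (hA3.of_le (by norm_num)) hALC r₀ hr₀ e
      (he.of_le (by norm_num)) hemem hgeo hunit0⟩
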